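/- arXiv:1211.0627 — 3 statements merged into one kernel-verified Lean document; each statement's English description precedes it below -/
import Mathlib

section
/- Let G be a finite simple 3-connected graph. Then |E(G)| - |V(G)| + 1 ≤ |C(G)|, where C(G) is the set of induced nonseparating cycles of G. -/
open SimpleGraph

variable {V : Type*} {W : Type*}

/-- A graph is 3-connected if deleting any set of at most two vertices
leaves a connected graph. -/
def ThreeConnected (G : SimpleGraph V) : Prop :=
  ∀ S : Set V, S.ncard ≤ 2 → (G.induce Sᶜ).Connected

/-- `C` induces a cycle in `G`: the induced subgraph on `C` is connected,
`2`-regular and has at least three vertices. -/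
def IsInducedCycle (G : SimpleGraph V) (C : Set V) : Prop :=
  3 ≤ C.ncard ∧ (G.induce C).Connected ∧
    ∀ x : C, ((G.induce C).neighborSet x).ncard = 2

/-- `C` is an induced nonseparating cycle of `G`: deleting `V(C)` leaves a
connected graph (the empty graph counts as connected). -/
def IsNonsepCycle (G : SimpleGraph V) (C : Set V) : Prop :=
  IsInducedCycle G C ∧ (G.induce Cᶜ).Preconnected

/-- The set `C(G)` of induced nonseparating cycles of `G`. -/
def nonsepCycles (G : SimpleGraph V) : Set (Set V) :=
  {C | IsNonsepCycle G C}

/-- A `ZMod 2`-labelling `φ` of pairs is balanced on `Y` if on the edges of `G` inside `Y` it is the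
coboundary of a vertex labelling. -/
def BalancedOn (G : SimpleGraph V) (φ : Sym2 V → ZMod 2) (Y : Set V) : Prop :=
  ∃ f : V → ZMod 2, ∀ u ∈ Y, ∀ v ∈ Y, G.Adj u v → f u + f v = φ s(u, v)

theorem zmod_two_eq_of_add_eq {a b c d p : ZMod 2} (h₁ : a + b = p) (h₂ : c + d = p)
    (h : a = c) : b = d := by
  subst h
  exact add_left_cancel (h₁.trans h₂.symm)

/-- The majority value of three elements of `ZMod 2`. -/
def majority (p q r : ZMod 2) : ZMod 2 := p * q + q * r + p * r

theorem majority_add_majority {p q r p' q' r' c : ZMod 2} (hp : p + p' = c) (hq : q + q' = c)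
    (hr : r + r' = c) : majority p q r + majority p' q' r' = c := by
  revert p q r p' q' r' c
  unfold majority
  decide

theorem majority_eq_left {p q r : ZMod 2} (h : p = q ∨ p = r) : majority p q r = p := by
  revert p q r
  unfold majority
  decide

theorem majority_eq_right {p q r : ZMod 2} (h : q = r) : majority p q r = q := by
  revert p q r
  unfold majority
  decide

/-- The vertex labelling witnessing that `Y` is balanced may be chosen to vanish at a given vertex. -/
theorem BalancedOn.exists_eq_zero {G : SimpleGraph V} {φ : Sym2 V → ZMod 2} {Y : Set V}
    (h : BalancedOn G φ Y) (k : V) :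
    ∃ f : V → ZMod 2, f k = 0 ∧ ∀ u ∈ Y, ∀ v ∈ Y, G.Adj u v → f u + f v = φ s(u, v) := by
  obtain ⟨f, hf⟩ := h
  refine ⟨fun v => f v + f k, CharTwo.add_self_eq_zero _, fun u hu v hv huv => ?_⟩
  rw [← hf u hu v hv huv]
  linear_combination CharTwo.add_self_eq_zero (f k)

/-- If a connected set `K` has three neighbours in `Y` each of whose deletion from `Y` leaves a
balanced set, then `Y` is balanced: take the majority of the three potentials. -/
theorem balancedOn_of_three_neighbors {G : SimpleGraph V} {φ : Sym2 V → ZMod 2} {Y K : Set V}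
    {k : V} {b : Fin 3 → V} (hKY : K ⊆ Y)
    (hK : ∀ D : V → ZMod 2, (∀ u ∈ K, ∀ v ∈ K, G.Adj u v → D u = D v) → ∀ u ∈ K, D u = D k)
    (hb : Function.Injective b) (hbY : ∀ i, b i ∈ Y) (hbK : ∀ i, b i ∉ K)
    (hadj : ∀ i, ∃ x ∈ K, G.Adj x (b i)) (hbal : ∀ i, BalancedOn G φ (Y \ {b i})) :
    BalancedOn G φ Y := by
  classical
  choose f hf0 hf using fun i => (hbal i).exists_eq_zero k
  have mem_diff : ∀ i, ∀ u ∈ K, u ∈ Y \ {b i} := fun i u hu =>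
    ⟨hKY hu, fun h => hbK i (h ▸ hu)⟩
  have hfK : ∀ i j, ∀ u ∈ K, f i u = f j u := by
    intro i j u hu
    have := hK (fun v => f i v + f j v) (fun u hu v hv huv => by
      have h₁ := hf i u (mem_diff i u hu) v (mem_diff i v hv) huv
      have h₂ := hf j u (mem_diff j u hu) v (mem_diff j v hv) huv
      have : ∀ p q r s c : ZMod 2, p + q = c → r + s = c → p + r = q + s := by decide
      exact this _ _ _ _ _ h₁ h₂) u hu
    simp only [hf0, add_zero] at this
    exact CharTwo.add_eq_zero.mp this
  have hfb : ∀ i j l, i ≠ l → j ≠ l → f i (b l) = f j (b l) := by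
    intro i j l hi hj
    obtain ⟨x, hx, hxb⟩ := hadj l
    exact zmod_two_eq_of_add_eq
      (hf i x (mem_diff i x hx) (b l) ⟨hbY l, fun h => hi (hb h).symm⟩ hxb)
      (hf j x (mem_diff j x hx) (b l) ⟨hbY l, fun h => hj (hb h).symm⟩ hxb) (hfK i j x hx)
  let g : V → ZMod 2 := fun v =>
    if v = b 0 then f 1 v else if v = b 1 then f 2 v else if v = b 2 then f 0 v
    else majority (f 0 v) (f 1 v) (f 2 v)
  have hgb : ∀ i l, i ≠ l → g (b l) = f i (b l) := by
    have h10 : b 1 ≠ b 0 := fun h => absurd (hb h) (by decide)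
    have h20 : b 2 ≠ b 0 := fun h => absurd (hb h) (by decide)
    have h21 : b 2 ≠ b 1 := fun h => absurd (hb h) (by decide)
    intro i l hil
    fin_cases l
    · simpa [g] using hfb 1 i 0 (by decide) hil
    · simpa [g, h10] using hfb 2 i 1 (by decide) hil
    · simpa [g, h20, h21] using hfb 0 i 2 (by decide) hil
  have hgv : ∀ v, (∀ i, v ≠ b i) → g v = majority (f 0 v) (f 1 v) (f 2 v) := by
    intro v hv
    simp [g, hv]
  have hout : ∀ l, ∀ v ∈ Y, (∀ i, v ≠ b i) → G.Adj v (b l) →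
      g v + g (b l) = φ s(v, b l) := by
    intro l v hvY hv hadjv
    have hfv : ∀ i, i ≠ l → f i v + f i (b l) = φ s(v, b l) := fun i hi =>
      hf i v ⟨hvY, hv i⟩ (b l) ⟨hbY l, fun h => hi (hb h).symm⟩ hadjv
    have heq : ∀ i j, i ≠ l → j ≠ l → f i v = f j v := fun i j hi hj =>
      add_right_cancel ((hfv i hi).trans ((hfb i j l hi hj) ▸ (hfv j hj).symm))
    rw [hgv v hv]
    fin_cases l
    · rw [majority_eq_right (heq 1 2 (by decide) (by decide)), hgb 1 _ (by decide)]
      exact hfv 1 (by decide)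
    · rw [majority_eq_left (.inr (heq 0 2 (by decide) (by decide))), hgb 0 _ (by decide)]
      exact hfv 0 (by decide)
    · rw [majority_eq_left (.inl (heq 0 1 (by decide) (by decide))), hgb 0 _ (by decide)]
      exact hfv 0 (by decide)
  refine ⟨g, fun u hu v hv huv => ?_⟩
  by_cases hub : ∃ l, u = b l
  · obtain ⟨l, rfl⟩ := hub
    by_cases hvb : ∃ m, v = b m
    · obtain ⟨m, rfl⟩ := hvb
      obtain ⟨i, hil, him⟩ : ∃ i : Fin 3, i ≠ l ∧ i ≠ m := by
        clear * -
        revert l m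
        decide
      rw [hgb i l hil, hgb i m him]
      exact hf i _ ⟨hu, fun h => hil (hb h).symm⟩ _ ⟨hv, fun h => him (hb h).symm⟩ huv
    · push Not at hvb
      rw [add_comm, Sym2.eq_swap]
      exact hout l v hv hvb huv.symm
  · push Not at hub
    by_cases hvb : ∃ m, v = b m
    · obtain ⟨m, rfl⟩ := hvb
      exact hout m u hu hub huv
    · push Not at hvb
      rw [hgv u hub, hgv v hvb]
      exact majority_add_majority (hf 0 u ⟨hu, hub 0⟩ v ⟨hv, hvb 0⟩ huv)
        (hf 1 u ⟨hu, hub 1⟩ v ⟨hv, hvb 1⟩ huv) (hf 2 u ⟨hu, hub 2⟩ v ⟨hv, hvb 2⟩ huv)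

theorem exists_injective_fin_three [Finite V] {S : Set V} (hS : 2 < S.ncard) :
    ∃ b : Fin 3 → V, Function.Injective b ∧ ∀ i, b i ∈ S := by
  obtain ⟨x, y, z, hx, hy, hz, hxy, hxz, hyz⟩ := (Set.two_lt_ncard_iff (Set.toFinite S)).1 hS
  refine ⟨![x, y, z], ?_, ?_⟩
  · intro i j h
    fin_cases i <;> fin_cases j <;> simp_all
  · intro i
    fin_cases i <;> simp [hx, hy, hz]

/-- A vertex with at most one neighbour in `Y` does not affect whether `Y` is balanced. -/
theorem balancedOn_of_neighbors_subsingleton {G : SimpleGraph V} {φ : Sym2 V → ZMod 2} {Y : Set V}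
    {a : V} (hbal : BalancedOn G φ (Y \ {a}))
    (ha : {v | v ∈ Y ∧ G.Adj a v}.Subsingleton) : BalancedOn G φ Y := by
  classical
  obtain ⟨f, hf⟩ := hbal
  obtain ⟨c, hc⟩ : ∃ c : ZMod 2, ∀ v ∈ Y, G.Adj a v → c + f v = φ s(a, v) := by
    rcases ha.eq_empty_or_singleton with h | ⟨w, h⟩
    · exact ⟨0, fun v hv hav => absurd (show v ∈ {v | v ∈ Y ∧ G.Adj a v} from ⟨hv, hav⟩)
        (by simp [h])⟩
    · refine ⟨φ s(a, w) - f w, fun v hv hav => ?_⟩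
      have : v ∈ {v | v ∈ Y ∧ G.Adj a v} := ⟨hv, hav⟩
      rw [h, Set.mem_singleton_iff] at this
      subst this
      ring
  refine ⟨Function.update f a c, fun u hu v hv huv => ?_⟩
  by_cases hua : u = a
  · subst hua
    simpa [huv.ne.symm] using hc v hv huv
  · by_cases hva : v = a
    · subst hva
      rw [add_comm, Sym2.eq_swap]
      simpa [hua] using hc u hu huv.symm
    · simpa [hua, hva] using hf u ⟨hu, hua⟩ v ⟨hv, hva⟩ huv

/-- Minimal unbalanced sets induce connected subgraphs. -/
theorem preconnected_of_minimal_unbalanced {G : SimpleGraph V} {φ : Sym2 V → ZMod 2} {Y : Set V}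
    (hY : ¬ BalancedOn G φ Y) (hmin : ∀ a ∈ Y, BalancedOn G φ (Y \ {a})) :
    (G.induce Y).Preconnected := by
  classical
  intro u v
  by_contra huv
  obtain ⟨f, hf⟩ := hmin v v.2
  obtain ⟨g, hg⟩ := hmin u u.2
  let L : Set V := {w | ∃ h : w ∈ Y, (G.induce Y).Reachable u ⟨w, h⟩}
  have hvL : (v : V) ∉ L := fun ⟨_, h⟩ => huv h
  have huL : (u : V) ∈ L := ⟨u.2, Reachable.refl _⟩
  have hL : ∀ x ∈ Y, ∀ y ∈ Y, G.Adj x y → x ∈ L → y ∈ L := by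
    rintro x hx y hy hxy ⟨_, h⟩
    exact ⟨hy, h.trans (Adj.reachable (by simpa using hxy))⟩
  refine hY ⟨fun w => if w ∈ L then f w else g w, fun x hx y hy hxy => ?_⟩
  by_cases hxL : x ∈ L
  · have hyL := hL x hx y hy hxy hxL
    simp only [hxL, hyL, if_true]
    exact hf x ⟨hx, fun h => hvL (h ▸ hxL)⟩ y ⟨hy, fun h => hvL (h ▸ hyL)⟩ hxy
  · have hyL : y ∉ L := fun h => hxL (hL y hy x hx hxy.symm h)
    simp only [hxL, hyL, if_false]
    exact hg x ⟨hx, fun h => hxL (h ▸ huL)⟩ y ⟨hy, fun h => hyL (h ▸ huL)⟩ hxy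

theorem ncard_neighborSet_induce (G : SimpleGraph V) (Y : Set V) (x : Y) :
    ((G.induce Y).neighborSet x).ncard = {v | v ∈ Y ∧ G.Adj x v}.ncard := by
  rw [← Set.ncard_image_of_injective _ Subtype.val_injective]
  congr 1
  ext v
  simp [and_comm]

/-- Minimal unbalanced sets are induced cycles. -/
theorem isInducedCycle_of_minimal_unbalanced [Finite V] {G : SimpleGraph V} {φ : Sym2 V → ZMod 2}
    {Y : Set V} (hY : ¬ BalancedOn G φ Y) (hmin : ∀ a ∈ Y, BalancedOn G φ (Y \ {a})) :
    IsInducedCycle G Y := by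
  have hne : Y.Nonempty := by
    by_contra h
    rw [Set.not_nonempty_iff_eq_empty] at h
    subst h
    exact hY ⟨0, by simp⟩
  have hdeg : ∀ x ∈ Y, {v | v ∈ Y ∧ G.Adj x v}.ncard = 2 := by
    intro x hx
    apply le_antisymm
    · by_contra! h
      obtain ⟨b, hb, hbS⟩ := exists_injective_fin_three h
      refine hY (balancedOn_of_three_neighbors (K := {x}) (k := x) (b := b) (by simpa using hx)
        (by simp) hb (fun i => (hbS i).1) (fun i h => (hbS i).2.ne h.symm)
        (fun i => ⟨x, rfl, (hbS i).2⟩) (fun i => hmin _ (hbS i).1))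
    · by_contra! h
      refine hY (balancedOn_of_neighbors_subsingleton (hmin x hx) ?_)
      rw [← Set.ncard_le_one_iff_subsingleton]
      omega
  refine ⟨?_, ?_, fun x => ?_⟩
  · obtain ⟨x, hx⟩ := hne
    have hsub : insert x {v | v ∈ Y ∧ G.Adj x v} ⊆ Y := by
      rintro v (rfl | hv)
      exacts [hx, hv.1]
    have := Set.ncard_le_ncard hsub (Set.toFinite Y)
    rw [Set.ncard_insert_of_notMem (by simp) (Set.toFinite _), hdeg x hx] at this
    exact this
  · have := hne.to_subtype
    exact ⟨preconnected_of_minimal_unbalanced hY hmin⟩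
  · rw [ncard_neighborSet_induce]
    exact hdeg x x.2

theorem preconnected_induce_insert {G : SimpleGraph V} {H : Set V} {a : V}
    (hH : (G.induce H).Preconnected) (ha : H = ∅ ∨ ∃ h ∈ H, G.Adj h a) :
    (G.induce (insert a H)).Preconnected := by
  rcases ha with rfl | ⟨h, hh, hadj⟩
  · rintro ⟨x, hx⟩ ⟨y, hy⟩
    simp only [insert_empty_eq, Set.mem_singleton_iff] at hx hy
    subst hx hy
    exact Reachable.refl _
  · have hreach : ∀ x : (insert a H : Set V),
        (G.induce (insert a H)).Reachable ⟨h, Set.mem_insert_of_mem _ hh⟩ x := by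
      rintro ⟨x, rfl | hx⟩
      · exact Adj.reachable (by simpa using hadj)
      · exact (hH ⟨h, hh⟩ ⟨x, hx⟩).map (G.induceHomOfLE (Set.subset_insert a H)).toHom
    exact fun x y => (hreach x).symm.trans (hreach y)

/-- If a labelling of a 3-connected graph is balanced on each induced nonseparating cycle, then it
is a coboundary. -/
theorem ThreeConnected.balancedOn_univ [Finite V] {G : SimpleGraph V} (hG : ThreeConnected G)
    {φ : Sym2 V → ZMod 2} (hφ : ∀ C ∈ nonsepCycles G, BalancedOn G φ C) :
    BalancedOn G φ Set.univ := by
  by_contra huniv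
  obtain ⟨H, ⟨hH, hHbal⟩, hmax⟩ := Set.Finite.exists_maximal
    (s := {H : Set V | (G.induce H).Preconnected ∧ ¬ BalancedOn G φ Hᶜ}) (Set.toFinite _)
    ⟨∅, fun x => x.2.elim, by simpa using huniv⟩
  have hdel : ∀ a ∈ Hᶜ, (H = ∅ ∨ ∃ h ∈ H, G.Adj h a) → BalancedOn G φ (Hᶜ \ {a}) := by
    intro a ha hadj
    by_contra hbal
    refine ha (hmax (y := insert a H) ⟨preconnected_induce_insert hH hadj, ?_⟩
      (Set.subset_insert a H) (Set.mem_insert a H))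
    rwa [Set.insert_eq, Set.union_comm, Set.compl_union]
  have hall : ∀ a ∈ Hᶜ, H = ∅ ∨ ∃ h ∈ H, G.Adj h a := by
    by_contra! ⟨y, hy, hHne, hyH⟩
    obtain ⟨h, hh⟩ := hHne
    let P : Set V := {v | v ∈ Hᶜ ∧ ∀ h ∈ H, ¬ G.Adj h v}
    let K : Set V := {v | Relation.ReflTransGen (fun u v => G.Adj u v ∧ v ∈ P) y v}
    have hyK : y ∈ K := Relation.ReflTransGen.refl
    have hKP : K ⊆ P := by
      intro v hv
      rcases Relation.ReflTransGen.cases_tail hv with rfl | ⟨_, _, h⟩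
      exacts [⟨hy, hyH⟩, h.2]
    let S : Set V := {v | v ∉ K ∧ ∃ x ∈ K, G.Adj x v}
    have hSP : ∀ v ∈ S, v ∉ P := fun v ⟨hvK, x, hx, hxv⟩ hv =>
      hvK (Relation.ReflTransGen.tail hx ⟨hxv, hv⟩)
    have hSH : ∀ v ∈ S, v ∈ Hᶜ := fun v ⟨_, x, hx, hxv⟩ hv => (hKP hx).2 v hv hxv.symm
    rcases le_or_gt S.ncard 2 with hS | hS
    · have hreach := (hG S hS).preconnected ⟨y, fun h => h.1 hyK⟩ ⟨h, fun h' => hSH h h' hh⟩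
      rw [reachable_iff_reflTransGen] at hreach
      have hK : ∀ w : (Sᶜ : Set V),
          Relation.ReflTransGen (G.induce Sᶜ).Adj ⟨y, fun h => h.1 hyK⟩ w → (w : V) ∈ K := by
        intro w hw
        induction hw with
        | refl => exact hyK
        | @tail b c _ hbc ih =>
          by_contra hc
          exact c.2 ⟨hc, b, ih, by simpa using hbc⟩
      exact (hKP (hK _ hreach)).1 hh
    · obtain ⟨b, hb, hbS⟩ := exists_injective_fin_three hS
      refine hHbal (balancedOn_of_three_neighbors (K := K) (k := y) (b := b)
        (fun v hv => (hKP hv).1) ?_ hb (fun i => hSH _ (hbS i)) (fun i => (hbS i).1)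
        (fun i => (hbS i).2) (fun i => hdel _ (hSH _ (hbS i)) (.inr ?_)))
      · intro D hD u hu
        have hu' : Relation.ReflTransGen (fun u v => G.Adj u v ∧ v ∈ P) y u := hu
        induction hu' with
        | refl => rfl
        | @tail p q hp hpq ih => rw [← ih hp, hD p hp q hu hpq.1]
      · by_contra! hnot
        exact hSP _ (hbS i) ⟨hSH _ (hbS i), hnot⟩
  have hcyc := isInducedCycle_of_minimal_unbalanced hHbal fun a ha => hdel a ha (hall a ha)
  exact hHbal (hφ _ ⟨hcyc, by rwa [compl_compl]⟩)

/-- The coboundary map of a graph over `ZMod 2`. -/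
def coboundary (G : SimpleGraph W) : (W → ZMod 2) →ₗ[ZMod 2] (G.edgeSet → ZMod 2) where
  toFun f e := Sym2.lift ⟨fun u v => f u + f v, fun _ _ => add_comm _ _⟩ (e : Sym2 W)
  map_add' f g := by
    ext ⟨e, he⟩
    induction e with
    | _ u v => simp only [Sym2.lift_mk, Pi.add_apply]; ring
  map_smul' c f := by
    ext ⟨e, he⟩
    induction e with
    | _ u v => simp only [Sym2.lift_mk, Pi.smul_apply, smul_eq_mul, RingHom.id_apply]; ring

theorem coboundary_apply (G : SimpleGraph W) (f : W → ZMod 2) {u v : W} (h : G.Adj u v) :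
    coboundary G f ⟨s(u, v), h⟩ = f u + f v := rfl

theorem finrank_range_coboundary [Finite W] {G : SimpleGraph W} (hG : G.Connected) :
    Module.finrank (ZMod 2) (LinearMap.range (coboundary G)) + 1 = Nat.card W := by
  have := Fintype.ofFinite W
  have := hG.nonempty
  have hker : LinearMap.ker (coboundary G) = Submodule.span (ZMod 2) {fun _ => 1} := by
    ext f
    rw [LinearMap.mem_ker, Submodule.mem_span_singleton]
    constructor
    · intro hf
      obtain ⟨r⟩ := hG.nonempty
      refine ⟨f r, funext fun v => ?_⟩
      have hr := hG.preconnected r v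
      rw [reachable_iff_reflTransGen] at hr
      simp only [Pi.smul_apply, smul_eq_mul, mul_one]
      induction hr with
      | refl => rfl
      | @tail p q _ hpq ih =>
        rw [ih]
        exact CharTwo.add_eq_zero.mp ((coboundary_apply G f hpq).symm.trans (congrFun hf _))
    · rintro ⟨c, rfl⟩
      ext ⟨e, he⟩
      induction e with
      | _ u v =>
        rw [coboundary_apply G _ he]
        simp only [Pi.smul_apply, Pi.zero_apply]
        exact CharTwo.add_self_eq_zero _
  have hrank := (coboundary G).finrank_range_add_finrank_ker
  rw [hker, finrank_span_singleton (by
    intro h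
    exact one_ne_zero (congrFun h (Classical.arbitrary W))), Module.finrank_pi] at hrank
  rw [hrank, Nat.card_eq_fintype_card]

theorem IsInducedCycle.card_edgeSet [Finite V] {G : SimpleGraph V} {C : Set V}
    (hC : IsInducedCycle G C) : Nat.card (G.induce C).edgeSet = Nat.card C := by
  classical
  have := Fintype.ofFinite V
  have h := (G.induce C).sum_degrees_eq_twice_card_edges
  have hdeg : ∀ x : C, (G.induce C).degree x = 2 := by
    intro x
    rw [← hC.2.2 x, Set.ncard_eq_toFinset_card', ← card_neighborFinset_eq_degree]
    rfl
  simp only [hdeg, Finset.sum_const, Finset.card_univ, smul_eq_mul] at h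
  rw [Nat.card_eq_fintype_card, Nat.card_eq_fintype_card, ← edgeFinset_card]
  omega

/-- Restriction of edge labellings to an induced subgraph. -/
def edgeRestrict (G : SimpleGraph V) (C : Set V) :
    (G.edgeSet → ZMod 2) →ₗ[ZMod 2] ((G.induce C).edgeSet → ZMod 2) :=
  LinearMap.funLeft (ZMod 2) (ZMod 2) (Embedding.induce C).toHom.mapEdgeSet

/-- The class of an edge labelling in the first cohomology of an induced subgraph. -/
noncomputable def cohomologyClass (G : SimpleGraph V) (C : Set V) :
    (G.edgeSet → ZMod 2) →ₗ[ZMod 2]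
      ((G.induce C).edgeSet → ZMod 2) ⧸ LinearMap.range (coboundary (G.induce C)) :=
  (LinearMap.range (coboundary (G.induce C))).mkQ ∘ₗ edgeRestrict G C

theorem IsInducedCycle.finrank_cohomology [Finite V] {G : SimpleGraph V} {C : Set V}
    (hC : IsInducedCycle G C) :
    Module.finrank (ZMod 2)
      (((G.induce C).edgeSet → ZMod 2) ⧸ LinearMap.range (coboundary (G.induce C))) = 1 := by
  have := Fintype.ofFinite (G.induce C).edgeSet
  have h₁ := finrank_range_coboundary hC.2.1
  have h₂ := (LinearMap.range (coboundary (G.induce C))).finrank_quotient_add_finrank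
  rw [Module.finrank_pi, ← Nat.card_eq_fintype_card, hC.card_edgeSet] at h₂
  omega

theorem balancedOn_of_cohomologyClass_eq_zero {G : SimpleGraph V} {C : Set V}
    {φ : Sym2 V → ZMod 2} (h : cohomologyClass G C (fun e => φ e) = 0) : BalancedOn G φ C := by
  classical
  rw [cohomologyClass, LinearMap.comp_apply, Submodule.mkQ_apply,
    Submodule.Quotient.mk_eq_zero] at h
  obtain ⟨f, hf⟩ := h
  refine ⟨fun v => if hv : v ∈ C then f ⟨v, hv⟩ else 0, fun u hu v hv huv => ?_⟩
  have hadj : (G.induce C).Adj ⟨u, hu⟩ ⟨v, hv⟩ := huv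
  simp only [hu, hv, dif_pos]
  exact (coboundary_apply _ f hadj).symm.trans (congrFun hf ⟨s(⟨u, hu⟩, ⟨v, hv⟩), hadj⟩)

theorem ThreeConnected.connected {G : SimpleGraph V} (hG : ThreeConnected G) : G.Connected := by
  have h := hG ∅ (by simp)
  rw [Set.compl_empty] at h
  exact (induceUnivIso G).connected_iff.mp h

/-- For every finite simple 3-connected graph `G`, `|E(G)| - |V(G)| + 1 ≤ |C(G)|`. -/
theorem stmt1 [Finite V] (G : SimpleGraph V) (hG : ThreeConnected G) :
    (G.edgeSet.ncard : ℤ) - (Nat.card V : ℤ) + 1 ≤ ((nonsepCycles G).ncard : ℤ) := by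
  classical
  have := Fintype.ofFinite G.edgeSet
  have := Fintype.ofFinite (nonsepCycles G)
  let Φ := LinearMap.pi fun C : nonsepCycles G => cohomologyClass G (C : Set V)
  have hker : LinearMap.ker Φ ≤ LinearMap.range (coboundary G) := by
    intro φ hφ
    let ψ : Sym2 V → ZMod 2 := fun e => if he : e ∈ G.edgeSet then φ ⟨e, he⟩ else 0
    have hψ : (fun e : G.edgeSet => ψ e) = φ := by
      ext e
      simp [ψ]
    obtain ⟨f, hf⟩ := hG.balancedOn_univ (φ := ψ) fun C hC =>
      balancedOn_of_cohomologyClass_eq_zero (by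
        rw [hψ]
        exact congrFun (LinearMap.mem_ker.mp hφ) ⟨C, hC⟩)
    refine ⟨f, ?_⟩
    rw [← hψ]
    ext ⟨e, he⟩
    induction e with
    | _ u v => exact hf u trivial v trivial he
  have hrange : Module.finrank (ZMod 2) (LinearMap.range Φ) ≤ (nonsepCycles G).ncard := by
    refine (Submodule.finrank_le _).trans ?_
    rw [Module.finrank_pi_fintype, Finset.sum_congr rfl fun C _ => C.2.1.finrank_cohomology]
    rw [← Nat.card_coe_set_eq, Nat.card_eq_fintype_card, ← Finset.card_univ,
      Finset.card_eq_sum_ones]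
  have hrank := Φ.finrank_range_add_finrank_ker
  rw [Module.finrank_pi, ← Nat.card_eq_fintype_card, Nat.card_coe_set_eq] at hrank
  have h₁ := Submodule.finrank_mono hker
  have h₂ := finrank_range_coboundary hG.connected
  omega
end

section
/- Let G be a finite simple 3-connected graph and suppose G = G₁ ⊕_T G₂ is a clique-sum of G₁ and G₂ along a triangle T. Then Λ(G) ≥ Λ(G₁) + Λ(G₂) - 2, where Λ(H) := |C(H)| - |E(H)| + |V(H)| and C(H) is the set of induced nonseparating cycles of H. -/
open SimpleGraph

variable {V : Type*} {W : Type*}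

/-- The graph characteristic `Λ(G) = |C(G)| - |E(G)| + |V(G)|`. -/
noncomputable def Lambda (G : SimpleGraph V) : ℤ :=
  ((nonsepCycles G).ncard : ℤ) - (G.edgeSet.ncard : ℤ) + (Nat.card V : ℤ)

/-- The induced nonseparating cycles of the induced subgraph of `G` on the
vertex set `Ws`, recorded as subsets of `V`. -/
def nonsepCyclesIn (G : SimpleGraph V) (Ws : Set V) : Set (Set V) :=
  {C | C ⊆ Ws ∧ IsInducedCycle G C ∧ (G.induce (Ws \ C)).Preconnected}

/-- The graph characteristic `Λ` of the induced subgraph of `G` on `Ws`. -/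
noncomputable def LambdaIn (G : SimpleGraph V) (Ws : Set V) : ℤ :=
  ((nonsepCyclesIn G Ws).ncard : ℤ) - (((G.induce Ws).edgeSet).ncard : ℤ) + (Ws.ncard : ℤ)

theorem ncard_edgeSet_induce (G : SimpleGraph V) (W : Set V) :
    (G.induce W).edgeSet.ncard = {e ∈ G.edgeSet | ∀ v ∈ e, v ∈ W}.ncard := by
  rw [← Set.ncard_image_of_injective _ (Sym2.map.injective Subtype.val_injective)]
  congr 1
  ext e
  constructor
  · rintro ⟨e, he, rfl⟩
    induction e using Sym2.ind with
    | _ x y => simpa using he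
  · induction e using Sym2.ind with
    | _ x y =>
      intro h
      simp only [Set.mem_ofPred_eq, mem_edgeSet, Sym2.mem_iff, forall_eq_or_imp, forall_eq] at h
      exact ⟨s(⟨x, h.2.1⟩, ⟨y, h.2.2⟩), by simpa using h.1, rfl⟩

theorem ncard_edgeSet_induce_of_isClique [Finite V] {G : SimpleGraph V} {T : Set V}
    (hT : G.IsClique T) : (G.induce T).edgeSet.ncard = T.ncard.choose 2 := by
  classical
  have := Fintype.ofFinite V
  rw [induce_eq_top.mpr hT]
  rw [Set.ncard_eq_toFinset_card', ← Set.fintypeCard_eq_ncard]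
  exact card_edgeFinset_top_eq_card_choose_two

/-- A property preserved along edges is preserved along reachability. -/
theorem SimpleGraph.Reachable.closed {H : SimpleGraph W} {P : W → Prop}
    (hP : ∀ x y, H.Adj x y → P x → P y) {x y : W} (h : H.Reachable x y) (hx : P x) : P y := by
  obtain ⟨p⟩ := h
  induction p with
  | nil => exact hx
  | cons hadj _ ih => exact ih (hP _ _ hadj hx)

theorem IsInducedCycle.eq_of_isClique [Finite V] {G : SimpleGraph V} {C T : Set V}
    (hC : IsInducedCycle G C) (hT : G.IsClique T) (hT3 : T.ncard = 3) (hTC : T ⊆ C) :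
    C = T := by
  obtain ⟨-, hconn, hdeg⟩ := hC
  refine Set.Subset.antisymm (fun c hc => ?_) hTC
  obtain ⟨t, ht⟩ : T.Nonempty := by
    rw [← Set.ncard_pos]; omega
  refine SimpleGraph.Reachable.closed (P := fun z : C => (z : V) ∈ T) ?_
    (hconn.preconnected ⟨t, hTC ht⟩ ⟨c, hc⟩) ht
  intro x y hxy hx
  have key : Subtype.val ⁻¹' (T \ {(x : V)}) = (G.induce C).neighborSet x := by
    refine Set.eq_of_subset_of_ncard_le ?_ ?_
    · rintro z ⟨hzT, hzx⟩
      exact hT hx hzT (Ne.symm hzx)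
    · rw [hdeg x, Set.ncard_preimage_of_injective_subset_range Subtype.val_injective,
        Set.ncard_sdiff_singleton_of_mem hx, hT3]
      rw [Subtype.range_coe]
      exact Set.sdiff_subset.trans hTC
  have hy : y ∈ (G.induce C).neighborSet x := hxy
  rw [← key] at hy
  exact hy.1

theorem SimpleGraph.Preconnected.compl_of_cliqueSum [Finite V] {G : SimpleGraph V}
    (hG : ThreeConnected G) {T A B C : Set V} (hT3 : T.ncard = 3)
    (hAB : Disjoint A B) (hUnion : A ∪ B = Tᶜ)
    (hsep : ∀ a ∈ A, ∀ b ∈ B, ¬ G.Adj a b) (hC : C ⊆ A ∪ T) (hTC : ¬ T ⊆ C)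
    (hpre : (G.induce ((A ∪ T) \ C)).Preconnected) : (G.induce Cᶜ).Preconnected := by
  obtain ⟨t, htT, htC⟩ := Set.not_subset.mp hTC
  have hle : (A ∪ T) \ C ⊆ Cᶜ := fun x hx => hx.2
  have h1 : ∀ x (hx : x ∈ A ∪ T) (hxC : x ∈ Cᶜ), (G.induce Cᶜ).Reachable ⟨x, hxC⟩ ⟨t, htC⟩ :=
    fun x hx hxC => (hpre ⟨x, hx, hxC⟩ ⟨t, Or.inr htT, htC⟩).map (induceHomOfLE G hle).toHom
  have hcov : ∀ x, x ∈ A ∨ x ∈ B ∨ x ∈ T := by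
    intro x
    by_cases hx : x ∈ T
    · exact .inr (.inr hx)
    · have : x ∈ A ∪ B := hUnion ▸ hx
      rcases this with h | h <;> simp [h]
  have hBT : ∀ x ∈ B, x ∉ T := fun x hx => (hUnion ▸ Or.inr hx : x ∈ Tᶜ)
  have hBC : ∀ x ∈ B, x ∈ Cᶜ := fun x hx hxC =>
    (hC hxC).elim (fun h => Set.disjoint_left.mp hAB h hx) (hBT x hx)
  have hcard : (C ∩ T).ncard ≤ 2 := by
    have : (C ∩ T).ncard < T.ncard :=
      Set.ncard_lt_ncard ⟨Set.inter_subset_right, fun h => htC (h htT).1⟩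
    omega
  have h2 : ∀ x (hxC : x ∈ Cᶜ), (G.induce Cᶜ).Reachable ⟨x, hxC⟩ ⟨t, htC⟩ := by
    intro x hxC
    by_contra hx
    have hxB : x ∈ B := by
      rcases hcov x with h | h | h
      · exact absurd (h1 x (.inl h) hxC) hx
      · exact h
      · exact absurd (h1 x (.inr h) hxC) hx
    have htR := SimpleGraph.Reachable.closed
      (P := fun z : ↥(C ∩ T)ᶜ => ∃ hz : (z : V) ∈ B,
        ¬ (G.induce Cᶜ).Reachable ⟨z, hBC z hz⟩ ⟨t, htC⟩) ?_
      ((hG _ hcard).preconnected ⟨x, fun h => hxC h.1⟩ ⟨t, fun h => htC h.1⟩) (Exists.intro hxB hx)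
    · exact hBT t htR.1 htT
    · rintro ⟨y, hy⟩ ⟨z, hz⟩ hyz ⟨hyB, hyR⟩
      replace hyz : G.Adj y z := hyz
      have hstep (hzC : z ∈ Cᶜ) : ¬ (G.induce Cᶜ).Reachable ⟨z, hzC⟩ ⟨t, htC⟩ := fun h =>
        hyR (Reachable.trans (Adj.reachable (by exact hyz)) h)
      rcases hcov z with h | h | h
      · exact absurd hyz.symm (hsep z h y hyB)
      · exact ⟨h, hstep _⟩
      · have hzC : z ∈ Cᶜ := fun h' => hz ⟨h', h⟩
        exact absurd (h1 z (.inr h) hzC) (hstep hzC)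
  exact fun x y => (h2 x x.2).trans (h2 y y.2).symm

theorem nonsepCyclesIn_sdiff_subset [Finite V] {G : SimpleGraph V}
    (hG : ThreeConnected G) {T A B : Set V} (hT : G.IsClique T) (hT3 : T.ncard = 3)
    (hAB : Disjoint A B) (hUnion : A ∪ B = Tᶜ) (hsep : ∀ a ∈ A, ∀ b ∈ B, ¬ G.Adj a b) :
    nonsepCyclesIn G (A ∪ T) \ {T} ⊆ nonsepCycles G := by
  rintro C ⟨⟨hC, hcyc, hpre⟩, hne⟩
  exact ⟨hcyc, hpre.compl_of_cliqueSum hG hT3 hAB hUnion hsep hC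
    fun h => hne (hcyc.eq_of_isClique hT hT3 h)⟩

/-- If the 3-connected graph `G` is the clique-sum `G₁ ⊕_T G₂` along a
triangle `T`, then `Λ(G) ≥ Λ(G₁) + Λ(G₂) - 2`. -/
theorem stmt5 [Finite V] (G : SimpleGraph V) (hG : ThreeConnected G)
    (T A B : Set V) (hT : G.IsClique T) (hT3 : T.ncard = 3)
    (hAB : Disjoint A B) (hUnion : A ∪ B = Tᶜ) (hA : A.Nonempty) (hB : B.Nonempty)
    (hsep : ∀ a ∈ A, ∀ b ∈ B, ¬ G.Adj a b) :
    Lambda G ≥ LambdaIn G (A ∪ T) + LambdaIn G (B ∪ T) - 2 := by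
  have hUnion' : B ∪ A = Tᶜ := Set.union_comm B A ▸ hUnion
  have hinter : (A ∪ T) ∩ (B ∪ T) = T := by
    rw [← Set.inter_union_distrib_right, hAB.inter_eq, Set.empty_union]
  have hunion : (A ∪ T) ∪ (B ∪ T) = Set.univ := by
    rw [← Set.union_union_distrib_right, hUnion, Set.compl_union_self]
  have hvert := Set.ncard_union_add_ncard_inter (A ∪ T) (B ∪ T)
  rw [hinter, hunion, Set.ncard_univ, hT3] at hvert
  have hedge : G.edgeSet.ncard + 3 =
      (G.induce (A ∪ T)).edgeSet.ncard + (G.induce (B ∪ T)).edgeSet.ncard := by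
    have h3 := ncard_edgeSet_induce_of_isClique hT
    rw [hT3, ncard_edgeSet_induce] at h3
    rw [ncard_edgeSet_induce, ncard_edgeSet_induce, ← Set.ncard_union_add_ncard_inter]
    congr 1
    · congr 1
      ext e
      induction e using Sym2.ind with
      | _ x y =>
        have hx : x ∈ (A ∪ B) ∪ T := by simp [hUnion]
        have hy : y ∈ (A ∪ B) ∪ T := by simp [hUnion]
        have hxy : G.Adj x y → ¬ (x ∈ A ∧ y ∈ B) := fun h h' => hsep x h'.1 y h'.2 h
        have hyx : G.Adj x y → ¬ (y ∈ A ∧ x ∈ B) := fun h h' => hsep y h'.1 x h'.2 h.symm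
        simp only [Set.mem_union, Set.mem_ofPred_eq, mem_edgeSet, Sym2.mem_iff, forall_eq_or_imp,
          forall_eq] at *
        tauto
    · rw [show 3 = Nat.choose 3 2 from rfl, ← h3]
      congr 1
      ext e
      have hmem (v : V) : v ∈ T ↔ v ∈ A ∪ T ∧ v ∈ B ∪ T := by
        rw [← Set.mem_inter_iff, hinter]
      simp only [Set.mem_inter_iff, Set.mem_ofPred_eq, hmem]
      grind
  have hdisj : Disjoint (nonsepCyclesIn G (A ∪ T) \ {T}) (nonsepCyclesIn G (B ∪ T) \ {T}) := by
    rw [Set.disjoint_left]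
    rintro C ⟨⟨hCA, hcyc, -⟩, hne⟩ ⟨⟨hCB, -⟩, -⟩
    refine hne (Set.eq_of_subset_of_ncard_le ?_ (hT3 ▸ hcyc.1))
    exact hinter ▸ Set.subset_inter hCA hCB
  have hcycles : (nonsepCyclesIn G (A ∪ T) \ {T}).ncard + (nonsepCyclesIn G (B ∪ T) \ {T}).ncard ≤
      (nonsepCycles G).ncard := by
    rw [← Set.ncard_union_eq hdisj]
    exact Set.ncard_le_ncard (Set.union_subset
      (nonsepCyclesIn_sdiff_subset hG hT hT3 hAB hUnion hsep)
      (nonsepCyclesIn_sdiff_subset hG hT hT3 hAB.symm hUnion'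
        fun b hb a ha h => hsep a ha b hb h.symm))
  have hcA := Set.le_ncard_sdiff {T} (nonsepCyclesIn G (A ∪ T))
  have hcB := Set.le_ncard_sdiff {T} (nonsepCyclesIn G (B ∪ T))
  rw [Set.ncard_singleton] at hcA hcB
  unfold Lambda LambdaIn
  omega
end

section
/- Let G be a finite simple graph that is the clique-sum G₁ ⊕_K G₂ of graphs G₁ and G₂ along a complete subgraph K. Then h(G) = max(h(G₁), h(G₂)), where h denotes the Hadwiger number; in particular, if h(G) = n then h(G₁) = n or h(G₂) = n. -/
open SimpleGraph

variable {V : Type*} {W : Type*}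

/-- `H` is a minor of `G`: there is a minor model assigning to each vertex of `H`
a nonempty connected branch set in `G`, pairwise disjoint, with edges of `H`
realized by edges between the corresponding branch sets. -/
def IsMinor (H : SimpleGraph W) (G : SimpleGraph V) : Prop :=
  ∃ f : W → Set V, (∀ i, (f i).Nonempty) ∧ (∀ i, (G.induce (f i)).Connected) ∧
    (Pairwise fun i j => Disjoint (f i) (f j)) ∧
    ∀ i j, H.Adj i j → ∃ a ∈ f i, ∃ b ∈ f j, G.Adj a b

/-- The Hadwiger number of `G`: the largest `n` such that the complete graph
`K_n` is a minor of `G`. -/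
noncomputable def hadwigerNumber (G : SimpleGraph V) : ℕ :=
  sSup {n | IsMinor (⊤ : SimpleGraph (Fin n)) G}

/-- Connectedness of a set of vertices of an induced subgraph can be tested in the ambient graph. -/
lemma connected_induce_induce_iff (G : SimpleGraph V) {S T : Set V} (hTS : T ⊆ S) :
    ((G.induce S).induce (Subtype.val ⁻¹' T)).Connected ↔ (G.induce T).Connected := by
  let e : (G.induce S).induce (Subtype.val ⁻¹' T) ≃g G.induce T :=
    { toFun := fun x => ⟨x.1.1, x.2⟩
      invFun := fun x => ⟨⟨x.1, hTS x.2⟩, x.2⟩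
      left_inv := fun _ => rfl
      right_inv := fun _ => rfl
      map_rel_iff' := Iff.rfl }
  exact e.connected_iff

/-- Minors of an induced subgraph are given by the minor models living inside its vertex set. -/
lemma isMinor_induce_iff (H : SimpleGraph W) (G : SimpleGraph V) (S : Set V) :
    IsMinor H (G.induce S) ↔
      ∃ f : W → Set V, (∀ i, f i ⊆ S) ∧ (∀ i, (G.induce (f i)).Connected) ∧
        (Pairwise fun i j => Disjoint (f i) (f j)) ∧
        ∀ i j, H.Adj i j → ∃ a ∈ f i, ∃ b ∈ f j, G.Adj a b := by
  constructor
  · rintro ⟨f, -, hc, hd, he⟩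
    have hS : ∀ i, Subtype.val '' f i ⊆ S := fun i => Subtype.coe_image_subset S (f i)
    refine ⟨fun i => Subtype.val '' f i, hS, fun i => ?_, fun i j hij => ?_, fun i j hij => ?_⟩
    · rw [← connected_induce_induce_iff G (hS i),
        Set.preimage_image_eq _ Subtype.val_injective]
      exact hc i
    · exact (Set.disjoint_image_iff Subtype.val_injective).2 (hd hij)
    · obtain ⟨a, ha, b, hb, hab⟩ := he i j hij
      exact ⟨a, ⟨a, ha, rfl⟩, b, ⟨b, hb, rfl⟩, hab⟩
  · rintro ⟨f, hS, hc, hd, he⟩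
    refine ⟨fun i => Subtype.val ⁻¹' f i, fun i => ?_,
      fun i => (connected_induce_induce_iff G (hS i)).2 (hc i),
      fun i j hij => (hd hij).preimage _, fun i j hij => ?_⟩
    · obtain ⟨x⟩ := (hc i).nonempty
      exact ⟨⟨x.1, hS i x.2⟩, x.2⟩
    · obtain ⟨a, ha, b, hb, hab⟩ := he i j hij
      exact ⟨⟨a, hS i ha⟩, ha, ⟨b, hS j hb⟩, hb, hab⟩

lemma IsMinor.of_induce {H : SimpleGraph W} {G : SimpleGraph V} {S : Set V}
    (h : IsMinor H (G.induce S)) : IsMinor H G := by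
  obtain ⟨f, -, hc, hd, he⟩ := (isMinor_induce_iff H G S).1 h
  exact ⟨f, fun i => Set.nonempty_coe_sort.1 (hc i).nonempty, hc, hd, he⟩

/-- A minor of a finite graph has at most as many vertices as the graph. -/
lemma IsMinor.card_le [Finite V] {H : SimpleGraph W} {G : SimpleGraph V}
    (h : IsMinor H G) : Nat.card W ≤ Nat.card V := by
  obtain ⟨f, hne, -, hd, -⟩ := h
  choose g hg using hne
  refine Nat.card_le_card_of_injective g fun i j hij => ?_
  by_contra hne
  exact Set.disjoint_left.1 (hd hne) (hg i) (hij ▸ hg j)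

lemma bddAbove_setOf_isMinor_top [Finite V] (G : SimpleGraph V) :
    BddAbove {n | IsMinor (⊤ : SimpleGraph (Fin n)) G} :=
  ⟨Nat.card V, fun n hn => by simpa using IsMinor.card_le hn⟩

lemma nonempty_setOf_isMinor_top (G : SimpleGraph V) :
    {n | IsMinor (⊤ : SimpleGraph (Fin n)) G}.Nonempty :=
  ⟨0, fun i => i.elim0, fun i => i.elim0, fun i => i.elim0, fun i => i.elim0, fun i => i.elim0⟩

section CliqueSum

variable {G : SimpleGraph V} {K A B T : Set V}

/-- A connected set avoiding the clique `K` and meeting the side `A` stays in `A`. -/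
lemma subset_of_connected_of_disjoint (hUnion : A ∪ B = Kᶜ)
    (hsep : ∀ a ∈ A, ∀ b ∈ B, ¬ G.Adj a b) (hT : (G.induce T).Connected)
    (hTK : Disjoint T K) (hTA : (T ∩ A).Nonempty) : T ⊆ A := by
  obtain ⟨u, huT, huA⟩ := hTA
  intro v hv
  have h := hT.preconnected ⟨u, huT⟩ ⟨v, hv⟩
  rw [reachable_iff_reflTransGen] at h
  suffices ∀ w : T, Relation.ReflTransGen (G.induce T).Adj ⟨u, huT⟩ w → w.1 ∈ A from this _ h
  intro w hw
  induction hw with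
  | refl => exact huA
  | @tail x y _ hxy ih =>
    have hy : y.1 ∈ A ∪ B := hUnion ▸ Set.disjoint_left.1 hTK y.2
    exact hy.resolve_right fun hyB => hsep _ ih _ hyB hxy

/-- A connected set meeting one side `A ∪ K` of a clique-sum meets it in a connected set. -/
lemma connected_induce_inter (hK : G.IsClique K) (hAB : Disjoint A B) (hUnion : A ∪ B = Kᶜ)
    (hsep : ∀ a ∈ A, ∀ b ∈ B, ¬ G.Adj a b) (hT : (G.induce T).Connected)
    (hTA : (T ∩ (A ∪ K)).Nonempty) : (G.induce (T ∩ (A ∪ K))).Connected := by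
  obtain ⟨u, hu⟩ := hTA
  have hcover : ∀ x, x ∈ A ∪ K ∨ x ∈ B := by
    intro x
    by_cases hx : x ∈ K
    · exact .inl (.inr hx)
    · have : x ∈ A ∪ B := hUnion ▸ hx
      exact this.imp .inl id
  have hcross : ∀ x ∈ A ∪ K, ∀ y ∈ B, G.Adj x y → x ∈ K := fun x hx y hy hxy =>
    hx.resolve_left fun hxA => hsep x hxA y hy hxy
  have hside : Disjoint (A ∪ K) B := Set.disjoint_union_left.2 ⟨hAB,
    Set.disjoint_left.2 fun x hxK hxB => (hUnion ▸ Or.inr hxB : x ∈ Kᶜ) hxK⟩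
  have key : ∀ w : T, Relation.ReflTransGen (G.induce T).Adj ⟨u, hu.1⟩ w →
      (∀ hw : w.1 ∈ A ∪ K, (G.induce (T ∩ (A ∪ K))).Reachable ⟨u, hu⟩ ⟨w.1, w.2, hw⟩) ∧
      (w.1 ∈ B → ∃ k, ∃ hk : k ∈ T ∩ (A ∪ K), k ∈ K ∧
        (G.induce (T ∩ (A ∪ K))).Reachable ⟨u, hu⟩ ⟨k, hk⟩) := by
    intro w hw
    induction hw with
    | refl =>
      exact ⟨fun _ => .rfl, fun hB => absurd hB (Set.disjoint_left.1 hside hu.2)⟩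
    | @tail x y _ hxy ih =>
      have hxy' : G.Adj x.1 y.1 := hxy
      refine ⟨fun hy => ?_, fun hy => ?_⟩
      · rcases hcover x.1 with hx | hx
        · exact (ih.1 hx).trans (Adj.reachable hxy')
        · obtain ⟨k, hk, hkK, hr⟩ := ih.2 hx
          have hyK := hcross _ hy _ hx hxy'.symm
          by_cases hky : k = y.1
          · subst hky
            exact hr
          · exact hr.trans (Adj.reachable (hK hkK hyK hky))
      · rcases hcover x.1 with hx | hx
        · exact ⟨x.1, ⟨x.2, hx⟩, hcross _ hx _ hy hxy', ih.1 hx⟩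
        · exact ih.2 hx
  rw [connected_iff_exists_forall_reachable]
  refine ⟨⟨u, hu⟩, fun w => ?_⟩
  have h := hT.preconnected ⟨u, hu.1⟩ ⟨w.1, w.2.1⟩
  rw [reachable_iff_reflTransGen] at h
  exact (key _ h).1 w.2.2

/-- A complete minor of a clique-sum none of whose branch sets lies strictly inside `B` restricts
to the other side. -/
lemma isMinor_induce_of_forall_not_subset {f : W → Set V} (hK : G.IsClique K)
    (hAB : Disjoint A B) (hUnion : A ∪ B = Kᶜ) (hsep : ∀ a ∈ A, ∀ b ∈ B, ¬ G.Adj a b)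
    (hc : ∀ i, (G.induce (f i)).Connected) (hd : Pairwise fun i j => Disjoint (f i) (f j))
    (he : ∀ i j, i ≠ j → ∃ a ∈ f i, ∃ b ∈ f j, G.Adj a b) (hf : ∀ i, ¬ f i ⊆ B) :
    IsMinor (⊤ : SimpleGraph W) (G.induce (A ∪ K)) := by
  have hcover : ∀ x, x ∉ B → x ∈ A ∪ K := by
    intro x hx
    by_cases hxK : x ∈ K
    · exact .inr hxK
    · have : x ∈ A ∪ B := hUnion ▸ hxK
      exact .inl (this.resolve_right hx)
  have hmeet : ∀ i, (f i ∩ (A ∪ K)).Nonempty := fun i => by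
    obtain ⟨x, hx, hxB⟩ := Set.not_subset.1 (hf i)
    exact ⟨x, hx, hcover x hxB⟩
  have hmeetK : ∀ i, ∀ x ∈ f i, x ∉ A → ∃ k ∈ f i, k ∈ K := by
    intro i x hx hxA
    by_contra! h
    have hdisj : Disjoint (f i) K := Set.disjoint_left.2 h
    obtain ⟨y, hy, hyAK⟩ := hmeet i
    exact hxA (subset_of_connected_of_disjoint hUnion hsep (hc i) hdisj
      ⟨y, hy, hyAK.resolve_right (h y hy)⟩ hx)
  have hcliq : ∀ i j, i ≠ j → (∃ k ∈ f i, k ∈ K) → (∃ k ∈ f j, k ∈ K) →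
      ∃ a ∈ f i ∩ (A ∪ K), ∃ b ∈ f j ∩ (A ∪ K), G.Adj a b := by
    rintro i j hij ⟨k, hki, hkK⟩ ⟨l, hlj, hlK⟩
    exact ⟨k, ⟨hki, .inr hkK⟩, l, ⟨hlj, .inr hlK⟩,
      hK hkK hlK fun h => Set.disjoint_left.1 (hd hij) hki (h ▸ hlj)⟩
  refine (isMinor_induce_iff _ _ _).2 ⟨fun i => f i ∩ (A ∪ K), fun i => Set.inter_subset_right,
    fun i => connected_induce_inter hK hAB hUnion hsep (hc i) (hmeet i),
    fun i j hij => (hd hij).mono Set.inter_subset_left Set.inter_subset_left, fun i j hij => ?_⟩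
  obtain ⟨a, ha, b, hb, hab⟩ := he i j hij
  by_cases haB : a ∈ B
  · exact hcliq i j hij (hmeetK i a ha (Set.disjoint_right.1 hAB haB))
      (hmeetK j b hb fun hbA => hsep b hbA a haB hab.symm)
  by_cases hbB : b ∈ B
  · exact hcliq i j hij (hmeetK i a ha fun haA => hsep a haA b hbB hab)
      (hmeetK j b hb (Set.disjoint_right.1 hAB hbB))
  exact ⟨a, ⟨ha, hcover a haB⟩, b, ⟨hb, hcover b hbB⟩, hab⟩

/-- The complete minors of a clique-sum are those of its two summands. -/
lemma isMinor_top_cliqueSum_iff (hK : G.IsClique K) (hAB : Disjoint A B) (hUnion : A ∪ B = Kᶜ)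
    (hsep : ∀ a ∈ A, ∀ b ∈ B, ¬ G.Adj a b) :
    IsMinor (⊤ : SimpleGraph W) G ↔
      IsMinor (⊤ : SimpleGraph W) (G.induce (A ∪ K)) ∨
        IsMinor (⊤ : SimpleGraph W) (G.induce (B ∪ K)) := by
  refine ⟨?_, fun h => h.elim IsMinor.of_induce IsMinor.of_induce⟩
  rintro ⟨f, hne, hc, hd, he⟩
  by_cases hB : ∃ j, f j ⊆ B
  · obtain ⟨j, hj⟩ := hB
    refine .inr (isMinor_induce_of_forall_not_subset hK hAB.symm (Set.union_comm A B ▸ hUnion)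
      (fun b hb a ha hab => hsep a ha b hb hab.symm) hc hd he fun i hi => ?_)
    have hij : i ≠ j := by
      rintro rfl
      obtain ⟨x, hx⟩ := hne i
      exact Set.disjoint_left.1 hAB (hi hx) (hj hx)
    obtain ⟨a, ha, b, hb, hab⟩ := he i j hij
    exact hsep a (hi ha) b (hj hb) hab
  · exact .inl (isMinor_induce_of_forall_not_subset hK hAB hUnion hsep hc hd he
      (not_exists.1 hB))

end CliqueSum

/-- If the finite simple graph `G` is the clique-sum `G₁ ⊕_K G₂` along a
clique `K`, then `h(G) = max (h(G₁), h(G₂))`; in particular, if `h(G) = n` then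
`h(G₁) = n` or `h(G₂) = n`. -/
theorem stmt9 [Finite V] (G : SimpleGraph V)
    (K A B : Set V) (hK : G.IsClique K)
    (hAB : Disjoint A B) (hUnion : A ∪ B = Kᶜ) (hA : A.Nonempty) (hB : B.Nonempty)
    (hsep : ∀ a ∈ A, ∀ b ∈ B, ¬ G.Adj a b) :
    hadwigerNumber G
        = max (hadwigerNumber (G.induce (A ∪ K))) (hadwigerNumber (G.induce (B ∪ K))) ∧
    ∀ n : ℕ, hadwigerNumber G = n →
      hadwigerNumber (G.induce (A ∪ K)) = n ∨ hadwigerNumber (G.induce (B ∪ K)) = n := by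
  have hmax : hadwigerNumber G = max (hadwigerNumber (G.induce (A ∪ K)))
      (hadwigerNumber (G.induce (B ∪ K))) := by
    rw [hadwigerNumber, hadwigerNumber, hadwigerNumber,
      ← csSup_union (bddAbove_setOf_isMinor_top _) (nonempty_setOf_isMinor_top _)
        (bddAbove_setOf_isMinor_top _) (nonempty_setOf_isMinor_top _)]
    congr 1
    ext n
    exact isMinor_top_cliqueSum_iff hK hAB hUnion hsep
  exact ⟨hmax, fun n hn => by omega⟩
end
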